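/- Let a, ad : (ℕ →₀ ℝ) →ₗ[ℝ] (ℕ →₀ ℝ) be the linear maps determined on the standard basis (e_m)_{m∈ℕ} of finitely supported real sequences by a e_m = √m · e_{m-1} (with a e_0 = 0) and ad e_m = √(m+1) · e_{m+1}, let N = ad ∘ a, and for n ≥ 1 set T = ad^n − a^n. Define the nested commutators by [T, N]_0 = N and [T, N]_{m+1} = T ∘ [T, N]_m − [T, N]_m ∘ T. Then for every odd natural number m, the coefficient at basis index 0 of ([T, N]_m) e_0 equals 0. -/

import Mathlib

/-- The nested commutator `[T, N]_0 = N`, `[T, N]_{m+1} = T ∘ [T, N]_m − [T, N]_m ∘ T`. -/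
noncomputable def nestedComm (T N : Module.End ℝ (ℕ →₀ ℝ)) : ℕ → Module.End ℝ (ℕ →₀ ℝ)
  | 0 => N
  | m + 1 => T * nestedComm T N m - nestedComm T N m * T

theorem annihilation_pow_single {a : Module.End ℝ (ℕ →₀ ℝ)}
    (ha : ∀ m : ℕ, a (Finsupp.single m 1) = Real.sqrt m • Finsupp.single (m - 1) 1) (n j : ℕ) :
    (a ^ n) (Finsupp.single j 1) =
      Real.sqrt (j.descFactorial n) • Finsupp.single (j - n) 1 := by
  induction n with
  | zero => simp
  | succ k ih =>
    rw [pow_succ', Module.End.mul_apply, ih, map_smul, ha, smul_smul, Nat.descFactorial_succ,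
      Nat.cast_mul, Real.sqrt_mul (Nat.cast_nonneg _), mul_comm, Nat.sub_sub]

theorem creation_pow_single {ad : Module.End ℝ (ℕ →₀ ℝ)}
    (had : ∀ m : ℕ, ad (Finsupp.single m 1) = Real.sqrt (m + 1) • Finsupp.single (m + 1) 1)
    (n j : ℕ) :
    (ad ^ n) (Finsupp.single j 1) =
      Real.sqrt ((j + 1).ascFactorial n) • Finsupp.single (j + n) 1 := by
  induction n with
  | zero => simp
  | succ k ih =>
    rw [pow_succ', Module.End.mul_apply, ih, map_smul, had, smul_smul, Nat.ascFactorial_succ,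
      Nat.cast_mul, Real.sqrt_mul (Nat.cast_nonneg _), mul_comm, add_assoc j k 1]
    congr 3
    push_cast
    ring

/-- The diagonal involution `e_j ↦ (-1) ^ ⌊j / n⌋ e_j`. -/
noncomputable def blockParity (n : ℕ) : Module.End ℝ (ℕ →₀ ℝ) :=
  Finsupp.linearCombination ℝ fun j => (-1 : ℝ) ^ (j / n) • Finsupp.single j 1

theorem blockParity_single (n j : ℕ) :
    blockParity n (Finsupp.single j 1) = (-1 : ℝ) ^ (j / n) • Finsupp.single j 1 := by
  simp [blockParity]

theorem end_ext_single {A B : Module.End ℝ (ℕ →₀ ℝ)}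
    (h : ∀ j, A (Finsupp.single j 1) = B (Finsupp.single j 1)) : A = B :=
  Finsupp.lhom_ext' fun j => LinearMap.ext_ring (h j)

theorem blockParity_apply_zero (n : ℕ) (f : ℕ →₀ ℝ) : blockParity n f 0 = f 0 := by
  have h : Finsupp.lapply 0 ∘ₗ blockParity n = (Finsupp.lapply 0 : (ℕ →₀ ℝ) →ₗ[ℝ] ℝ) := by
    refine Finsupp.lhom_ext' fun j => LinearMap.ext_ring ?_
    rcases j with _ | j <;> simp [blockParity_single]
  exact LinearMap.congr_fun h f

theorem blockParity_mul_annihilation_pow {a : Module.End ℝ (ℕ →₀ ℝ)}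
    (ha : ∀ m : ℕ, a (Finsupp.single m 1) = Real.sqrt m • Finsupp.single (m - 1) 1)
    {n : ℕ} (hn : 1 ≤ n) : blockParity n * a ^ n = -(a ^ n * blockParity n) := by
  refine end_ext_single fun j => ?_
  simp only [Module.End.mul_apply, LinearMap.neg_apply, annihilation_pow_single ha, map_smul,
    blockParity_single]
  rcases lt_or_ge j n with h | h
  · simp [Nat.descFactorial_of_lt h]
  · rw [Nat.div_eq_sub_div hn h, pow_succ, smul_comm]
    simp

theorem blockParity_mul_creation_pow {ad : Module.End ℝ (ℕ →₀ ℝ)}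
    (had : ∀ m : ℕ, ad (Finsupp.single m 1) = Real.sqrt (m + 1) • Finsupp.single (m + 1) 1)
    {n : ℕ} (hn : 1 ≤ n) : blockParity n * ad ^ n = -(ad ^ n * blockParity n) := by
  refine end_ext_single fun j => ?_
  simp only [Module.End.mul_apply, LinearMap.neg_apply, creation_pow_single had, map_smul,
    blockParity_single]
  rw [Nat.add_div_right _ hn, pow_succ, smul_comm]
  simp

theorem blockParity_mul_number {a ad : Module.End ℝ (ℕ →₀ ℝ)}
    (ha : ∀ m : ℕ, a (Finsupp.single m 1) = Real.sqrt m • Finsupp.single (m - 1) 1)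
    (had : ∀ m : ℕ, ad (Finsupp.single m 1) = Real.sqrt (m + 1) • Finsupp.single (m + 1) 1)
    (n : ℕ) : blockParity n * (ad * a) = ad * a * blockParity n := by
  refine end_ext_single fun j => ?_
  rcases j with _ | j
  · simp [Module.End.mul_apply, ha, blockParity_single]
  · simp only [Module.End.mul_apply, ha, had, map_smul, blockParity_single, Nat.add_sub_cancel]
    module

theorem mul_sub_of_anticommute {R : Type*} [Ring R] {P A B : R}
    (hA : P * A = -(A * P)) (hB : P * B = -(B * P)) : P * (A - B) = -((A - B) * P) := by
  rw [mul_sub, sub_mul, hA, hB]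
  abel

theorem mul_commutator_of_anticommute {R : Type*} [Ring R] [Algebra ℝ R] {P T X : R} {s : ℝ}
    (hT : P * T = -(T * P)) (hX : P * X = s • (X * P)) :
    P * (T * X - X * T) = (-s) • ((T * X - X * T) * P) := by
  have h₁ : P * (T * X) = -(s • (T * X * P)) := by
    rw [← mul_assoc, hT, neg_mul, mul_assoc, hX, mul_smul_comm, mul_assoc]
  have h₂ : P * (X * T) = -(s • (X * T * P)) := by
    rw [← mul_assoc, hX, smul_mul_assoc, mul_assoc, hT, mul_neg, smul_neg, mul_assoc]
  rw [mul_sub, sub_mul, h₁, h₂]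
  module

theorem mul_nestedComm_of_anticommute {P T N : Module.End ℝ (ℕ →₀ ℝ)}
    (hT : P * T = -(T * P)) (hN : P * N = N * P) (m : ℕ) :
    P * nestedComm T N m = (-1 : ℝ) ^ m • (nestedComm T N m * P) := by
  induction m with
  | zero => simpa [nestedComm] using hN
  | succ k ih =>
    rw [pow_succ, mul_neg_one]
    exact mul_commutator_of_anticommute (R := Module.End ℝ (ℕ →₀ ℝ)) hT ih

/-- With `a, ad` the annihilation/creation operators on `ℕ →₀ ℝ`, `N = ad ∘ a` the
number operator and `T = adⁿ − aⁿ` (for `n ≥ 1`), for every odd `m` the coefficient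
at basis index `0` of `([T, N]_m) e_0` vanishes: the odd Taylor coefficients of the
average photon number of the generalized squeezed state `U_n(r)|0⟩` are zero. -/
theorem odd_taylor_coefficients_vanish
    (a ad : Module.End ℝ (ℕ →₀ ℝ))
    (ha : ∀ m : ℕ, a (Finsupp.single m 1) = Real.sqrt m • Finsupp.single (m - 1) 1)
    (had : ∀ m : ℕ, ad (Finsupp.single m 1) = Real.sqrt (m + 1) • Finsupp.single (m + 1) 1)
    (n : ℕ) (hn : 1 ≤ n) (m : ℕ) (hm : Odd m) :
    (nestedComm (ad ^ n - a ^ n) (ad * a) m (Finsupp.single 0 1)) 0 = 0 := by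
  have hT : blockParity n * (ad ^ n - a ^ n) = -((ad ^ n - a ^ n) * blockParity n) :=
    mul_sub_of_anticommute (R := Module.End ℝ (ℕ →₀ ℝ)) (blockParity_mul_creation_pow had hn)
      (blockParity_mul_annihilation_pow ha hn)
  have h := mul_nestedComm_of_anticommute hT (blockParity_mul_number ha had n) m
  have h0 := DFunLike.congr_fun (LinearMap.congr_fun h (Finsupp.single 0 1)) 0
  simp only [Module.End.mul_apply, blockParity_apply_zero, hm.neg_one_pow, LinearMap.smul_apply,
    blockParity_single, Nat.zero_div, pow_zero, one_smul, Finsupp.smul_apply, smul_eq_mul] at h0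
  linarith
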